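/- arXiv:1806.03617 — 3 statements merged into one kernel-verified Lean document; each statement's English description precedes it below -/
import Mathlib

section
/- Fix w_l ∈ ℝ, w̄ > 0 and p ∈ [1,∞]. There exists a constant C = C(p, w_l, w̄) > 0 such that for every w_r with 0 < w̃ := w_r − w_l ≤ w̄, the characteristic solution ŵ of the Burgers equation with initial data w₀(x) = (w_r + w_l)/2 + (w̃/2)·tanh x satisfies, for all t ≥ 0: ‖∂_x ŵ(t,·)‖_{L^p(ℝ)} ≤ C·min{ w̃, w̃^(1/p)·(1+t)^(−1+1/p) } and ‖∂_x² ŵ(t,·)‖_{L^p(ℝ)} ≤ C·min{ w̃, (1+t)^(−1) }, where for p = ∞ the expression w̃^(1/p)·(1+t)^(−1+1/p) is interpreted as (1+t)^(−1). -/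
open Real

/-- Burgers initial data `w₀(x) = (w_r+w_l)/2 + ((w_r-w_l)/2)·tanh x`. -/
noncomputable def w0 (wl wr x : ℝ) : ℝ :=
  (wr + wl) / 2 + ((wr - wl) / 2) * Real.tanh x

open Classical in
/-- The characteristic solution of Burgers' equation with initial data `w0 wl wr`:
`ŵ(t,x) = w₀(y(t,x))` where `y(t,x)` is the (unique, for `t ≥ 0`) root of
`y + t·w₀(y) = x`. -/
noncomputable def burgersSol (wl wr t x : ℝ) : ℝ :=
  if h : ∃ y : ℝ, y + t * w0 wl wr y = x then w0 wl wr h.choose else 0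

open MeasureTheory Set Filter Topology in
/-- Interpolation between `L¹` and `L^∞`. -/
theorem eLpNorm_le_of_bound_of_lintegral_le {f : ℝ → ℝ} {M N : ℝ} {p : ENNReal} (hp : 1 ≤ p)
    (hM : 0 < M) (hN : 0 < N) (hf : ∀ x, |f x| ≤ M)
    (hfN : ∫⁻ x, ‖f x‖ₑ ≤ ENNReal.ofReal N) :
    eLpNorm f p volume ≤ ENNReal.ofReal (M ^ (1 - 1 / p.toReal) * N ^ (1 / p.toReal)) := by
  rcases eq_or_ne p ⊤ with rfl | htop
  · simpa using eLpNormEssSup_le_of_ae_bound (μ := volume) (Eventually.of_forall hf)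
  have hr : 1 ≤ p.toReal := by simpa using ENNReal.toReal_mono htop hp
  rw [eLpNorm_eq_lintegral_rpow_enorm_toReal (by positivity) htop]
  set r := p.toReal
  have key : ∫⁻ x, ‖f x‖ₑ ^ r ≤ ENNReal.ofReal M ^ (r - 1) * ENNReal.ofReal N := by
    calc ∫⁻ x, ‖f x‖ₑ ^ r ≤ ∫⁻ x, ENNReal.ofReal M ^ (r - 1) * ‖f x‖ₑ := by
          refine lintegral_mono fun x => ?_
          have h : ‖f x‖ₑ ^ r = ‖f x‖ₑ ^ (r - 1) * ‖f x‖ₑ := by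
            conv_lhs => rw [show r = (r - 1) + 1 by ring]
            rw [ENNReal.rpow_add_of_nonneg _ _ (by linarith) zero_le_one, ENNReal.rpow_one]
          rw [h]
          gcongr
          rw [Real.enorm_eq_ofReal_abs]
          exact ENNReal.ofReal_le_ofReal (hf x)
      _ = ENNReal.ofReal M ^ (r - 1) * ∫⁻ x, ‖f x‖ₑ :=
          lintegral_const_mul' _ _
            (ENNReal.rpow_ne_top_of_nonneg (by linarith) ENNReal.ofReal_ne_top)
      _ ≤ _ := by gcongr
  calc (∫⁻ x, ‖f x‖ₑ ^ r) ^ (1 / r)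
      ≤ (ENNReal.ofReal M ^ (r - 1) * ENNReal.ofReal N) ^ (1 / r) := by gcongr
    _ = _ := by
        rw [ENNReal.mul_rpow_of_nonneg _ _ (by positivity), ← ENNReal.rpow_mul,
          ENNReal.ofReal_mul (by positivity), ENNReal.ofReal_rpow_of_pos hM,
          ENNReal.ofReal_rpow_of_pos hN]
        congr 3
        field_simp

open MeasureTheory Set in
theorem setLIntegral_enorm_deriv_le_of_nonneg {f f' : ℝ → ℝ} {s : Set ℝ} {A B : ℝ}
    (hs : MeasurableSet s) (hconv : Convex ℝ s) (hf : ∀ x, HasDerivAt f (f' x) x)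
    (hf' : ∀ x ∈ s, 0 ≤ f' x) (hAB : ∀ x, f x ∈ Icc A B) :
    ∫⁻ x in s, ‖f' x‖ₑ ≤ ENNReal.ofReal (B - A) := by
  have hmono : MonotoneOn f s :=
    monotoneOn_of_hasDerivWithinAt_nonneg hconv
      (fun x _ => (hf x).continuousAt.continuousWithinAt)
      (fun x _ => (hf x).hasDerivWithinAt) (fun x hx => hf' x (interior_subset hx))
  calc ∫⁻ x in s, ‖f' x‖ₑ = ∫⁻ x in s, ENNReal.ofReal (f' x) :=
        setLIntegral_congr_fun hs fun x hx => Real.enorm_of_nonneg (hf' x hx)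
    _ = volume (f '' s) :=
        lintegral_deriv_eq_volume_image_of_monotoneOn hs
          (fun x _ => (hf x).hasDerivWithinAt) hmono
    _ ≤ volume (Icc A B) := measure_mono (image_subset_iff.2 fun x _ => hAB x)
    _ = _ := Real.volume_Icc

open MeasureTheory Set in
/-- The total variation of a function with values in `[A, B]` which increases up to `c` and
decreases afterwards is at most `2 (B - A)`. -/
theorem lintegral_enorm_deriv_le_of_unimodal {f f' : ℝ → ℝ} {A B c : ℝ}
    (hf : ∀ x, HasDerivAt f (f' x) x) (hleft : ∀ x ≤ c, 0 ≤ f' x) (hright : ∀ x > c, f' x ≤ 0)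
    (hAB : ∀ x, f x ∈ Icc A B) :
    ∫⁻ x, ‖f' x‖ₑ ≤ ENNReal.ofReal (2 * (B - A)) := by
  have hBA : 0 ≤ B - A := sub_nonneg.2 ((hAB c).1.trans (hAB c).2)
  have h1 := setLIntegral_enorm_deriv_le_of_nonneg measurableSet_Iic (convex_Iic c) hf hleft hAB
  have h2 := setLIntegral_enorm_deriv_le_of_nonneg (f := fun x => -f x) (f' := fun x => -f' x)
    (A := -B) (B := -A) measurableSet_Ioi (convex_Ioi c) (fun x => (hf x).fun_neg)
    (fun x hx => neg_nonneg.2 (hright x hx))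
    (fun x => ⟨neg_le_neg (hAB x).2, neg_le_neg (hAB x).1⟩)
  simp only [enorm_neg] at h2
  rw [← lintegral_add_compl _ (measurableSet_Iic (a := c)), compl_Iic, two_mul,
    ENNReal.ofReal_add hBA hBA]
  exact add_le_add h1 (h2.trans_eq (by rw [neg_sub_neg]))

theorem Real.hasDerivAt_tanh_one_sub_sq (x : ℝ) : HasDerivAt Real.tanh (1 - Real.tanh x ^ 2) x := by
  have hc : Real.cosh x ≠ 0 := (Real.cosh_pos x).ne'
  have h := (Real.hasDerivAt_sinh x).fun_div (Real.hasDerivAt_cosh x) hc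
  have he : Real.tanh = fun y => Real.sinh y / Real.cosh y :=
    funext Real.tanh_eq_sinh_div_cosh
  rw [he]
  refine h.congr_deriv ?_
  field_simp

theorem Real.tanh_nonneg_of_nonneg {x : ℝ} (hx : 0 ≤ x) : 0 ≤ Real.tanh x := by
  rw [Real.tanh_eq_sinh_div_cosh]
  exact div_nonneg (Real.sinh_nonneg_iff.2 hx) (Real.cosh_pos x).le

theorem Real.tanh_nonpos_of_nonpos {x : ℝ} (hx : x ≤ 0) : Real.tanh x ≤ 0 := by
  rw [Real.tanh_eq_sinh_div_cosh]
  exact div_nonpos_of_nonpos_of_nonneg (Real.sinh_nonpos_iff.2 hx) (Real.cosh_pos x).le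

theorem hasDerivAt_w0 (wl wr x : ℝ) :
    HasDerivAt (w0 wl wr) ((wr - wl) / 2 * (1 - Real.tanh x ^ 2)) x :=
  ((Real.hasDerivAt_tanh_one_sub_sq x).const_mul _).const_add _

theorem w0_mem_Icc {wl wr : ℝ} (h : 0 < wr - wl) (x : ℝ) : w0 wl wr x ∈ Set.Icc wl wr := by
  have h1 := Real.tanh_lt_one x
  have h2 := Real.neg_one_lt_tanh x
  constructor <;> unfold w0 <;> nlinarith

theorem hasDerivAt_characteristic (wl wr t y : ℝ) :
    HasDerivAt (fun y => y + t * w0 wl wr y)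
      (1 + t * ((wr - wl) / 2 * (1 - Real.tanh y ^ 2))) y :=
  (hasDerivAt_id y).add ((hasDerivAt_w0 wl wr y).const_mul t)

theorem characteristic_deriv_pos {wl wr t : ℝ} (h : 0 < wr - wl) (ht : 0 ≤ t) (y : ℝ) :
    0 < 1 + t * ((wr - wl) / 2 * (1 - Real.tanh y ^ 2)) := by
  have := sub_pos.2 (Real.tanh_sq_lt_one y)
  positivity

open Filter Topology in
/-- For `t ≥ 0` the characteristic map is a diffeomorphism of the line. Its inverse `Y` is strictly
increasing, and the characteristic solution is `w0 ∘ Y`. -/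
theorem exists_characteristic_inverse {wl wr t : ℝ} (h : 0 < wr - wl) (ht : 0 ≤ t) :
    ∃ Y : ℝ → ℝ, StrictMono Y ∧ Function.Surjective Y ∧
      (∀ x, HasDerivAt Y (1 + t * ((wr - wl) / 2 * (1 - Real.tanh (Y x) ^ 2)))⁻¹ x) ∧
      ∀ x, burgersSol wl wr t x = w0 wl wr (Y x) := by
  set g : ℝ → ℝ := fun y => y + t * w0 wl wr y with hg
  have hgd := hasDerivAt_characteristic wl wr t
  have hmono : StrictMono g := strictMono_of_hasDerivAt_pos hgd (characteristic_deriv_pos h ht)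
  have hcont : Continuous g := continuous_iff_continuousAt.2 fun y => (hgd y).continuousAt
  have hsurj : Function.Surjective g := by
    refine hcont.surjective ?_ ?_
    · refine tendsto_atTop_mono (f := fun y => y + t * wl) (fun y => ?_)
        (tendsto_atTop_add_const_right _ _ tendsto_id)
      have := mul_le_mul_of_nonneg_left (w0_mem_Icc h y).1 ht
      simp only [hg]; linarith
    · refine tendsto_atBot_mono (f := fun y => y + t * wr) (fun y => ?_)
        (tendsto_atBot_add_const_right _ _ tendsto_id)
      have := mul_le_mul_of_nonneg_left (w0_mem_Icc h y).2 ht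
      simp only [hg]; linarith
  let e : ℝ ≃o ℝ := hmono.orderIsoOfSurjective g hsurj
  have he : ∀ x, g (e.symm x) = x := fun x => e.apply_symm_apply x
  refine ⟨e.symm, e.symm.strictMono, e.symm.surjective, fun x => ?_, fun x => ?_⟩
  · exact HasDerivAt.of_local_left_inverse e.symm.continuous.continuousAt (hgd _)
      (characteristic_deriv_pos h ht _).ne' (Eventually.of_forall he)
  · have hex : ∃ y : ℝ, y + t * w0 wl wr y = x := ⟨e.symm x, he x⟩
    rw [burgersSol, dif_pos hex]
    congr 1
    exact hmono.injective (hex.choose_spec.trans (he x).symm)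

/-- With `M = a / (1 + t a)`, `a = (wr - wl) / 2`: the pointwise and `L¹` bounds of the first two
space derivatives of the characteristic solution. -/
theorem burgersSol_deriv_bounds {wl wr t M : ℝ} (h : 0 < wr - wl) (ht : 0 ≤ t)
    (hM : M = (wr - wl) / 2 / (1 + t * ((wr - wl) / 2))) :
    ((∀ x, |deriv (burgersSol wl wr t) x| ≤ M) ∧
      ∫⁻ x, ‖deriv (burgersSol wl wr t) x‖ₑ ≤ ENNReal.ofReal (wr - wl)) ∧
    ((∀ x, |deriv (deriv (burgersSol wl wr t)) x| ≤ 2 * M) ∧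
      ∫⁻ x, ‖deriv (deriv (burgersSol wl wr t)) x‖ₑ ≤ ENNReal.ofReal (2 * M)) := by
  obtain ⟨Y, hYmono, hYsurj, hYd, hY⟩ := exists_characteristic_inverse h ht
  set a := (wr - wl) / 2 with ha
  have hapos : 0 < a := by positivity
  set q : ℝ → ℝ := fun x => 1 - Real.tanh (Y x) ^ 2 with hq
  have hq0 : ∀ x, 0 < q x := fun x => sub_pos.2 (Real.tanh_sq_lt_one _)
  have hq1 : ∀ x, q x ≤ 1 := fun x => sub_le_self _ (sq_nonneg _)
  have hD : ∀ x, 0 < 1 + t * (a * q x) := fun x => characteristic_deriv_pos h ht _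
  have hD1 : ∀ x, 1 ≤ 1 + t * (a * q x) := fun x => by
    have := hq0 x
    have : 0 ≤ t * (a * q x) := by positivity
    linarith
  set φ : ℝ → ℝ := fun x => a * q x / (1 + t * (a * q x)) with hφ
  have hw : ∀ x, HasDerivAt (burgersSol wl wr t) (φ x) x := fun x => by
    rw [funext hY]
    exact (hasDerivAt_w0 wl wr (Y x)).comp x (hYd x)
  have hw' : deriv (burgersSol wl wr t) = φ := funext fun x => (hw x).deriv
  have hTd : ∀ x, HasDerivAt (fun x => Real.tanh (Y x)) (q x * (1 + t * (a * q x))⁻¹) x :=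
    fun x => (Real.hasDerivAt_tanh_one_sub_sq (Y x)).comp x (hYd x)
  set ψ : ℝ → ℝ := fun x => -2 * Real.tanh (Y x) * (φ x / (1 + t * (a * q x)) ^ 2) with hψ
  have hφd : ∀ x, HasDerivAt φ (ψ x) x := fun x => by
    have hqd : HasDerivAt (fun x => a * q x)
        (a * -(2 * Real.tanh (Y x) * (q x * (1 + t * (a * q x))⁻¹))) x := by
      simpa using (((hTd x).fun_pow 2).const_sub 1).const_mul a
    refine (hqd.fun_div ((hqd.const_mul t).const_add 1) (hD x).ne').congr_deriv ?_
    have := (hD x).ne'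
    simp only [hψ, hφ]
    field_simp
    ring
  have hφ' : deriv φ = ψ := funext fun x => (hφd x).deriv
  have hφ0 : ∀ x, 0 ≤ φ x := fun x => div_nonneg (mul_pos hapos (hq0 x)).le (hD x).le
  have hφM : ∀ x, φ x ≤ M := fun x => by
    rw [hM, div_le_div_iff₀ (hD x) (by positivity)]
    have := mul_le_mul_of_nonneg_left (hq1 x) hapos.le
    linarith
  have hR0 : ∀ x, 0 ≤ φ x / (1 + t * (a * q x)) ^ 2 := fun x => div_nonneg (hφ0 x) (sq_nonneg _)
  rw [hw', hφ']
  refine ⟨⟨fun x => ?_, ?_⟩, fun x => ?_, ?_⟩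
  · rw [abs_of_nonneg (hφ0 x)]
    exact hφM x
  · simpa using setLIntegral_enorm_deriv_le_of_nonneg MeasurableSet.univ convex_univ hw
      (fun x _ => hφ0 x) (fun x => by rw [hY]; exact w0_mem_Icc h _)
  · have h1 : φ x / (1 + t * (a * q x)) ^ 2 ≤ M :=
      (div_le_self (hφ0 x) (one_le_pow₀ (hD1 x))).trans (hφM x)
    simp only [hψ]
    rw [abs_mul, abs_mul, abs_of_nonneg (hR0 x)]
    have h2 := (Real.abs_tanh_lt_one (Y x)).le
    have h3 : |Real.tanh (Y x)| * (φ x / (1 + t * (a * q x)) ^ 2) ≤ 1 * M :=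
      mul_le_mul h2 h1 (hR0 x) zero_le_one
    norm_num
    linarith
  · obtain ⟨c, hc⟩ := hYsurj 0
    have := lintegral_enorm_deriv_le_of_unimodal (c := c) (A := 0) (B := M) hφd
      (fun x hx => mul_nonneg (mul_nonneg_of_nonpos_of_nonpos (by norm_num)
        (Real.tanh_nonpos_of_nonpos (hc ▸ hYmono.monotone hx))) (hR0 x))
      (fun x hx => mul_nonpos_of_nonpos_of_nonneg (mul_nonpos_of_nonpos_of_nonneg (by norm_num)
        (Real.tanh_nonneg_of_nonneg (hc ▸ (hYmono hx).le))) (hR0 x))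
      (fun x => ⟨hφ0 x, hφM x⟩)
    simpa using this

open MeasureTheory ENNReal in
/-- `L^p` decay estimates for the first and second spatial derivatives of the
characteristic Burgers solution: for fixed `w_l`, `w̄ > 0` and `p ∈ [1,∞]` there is
`C = C(p, w_l, w̄) > 0` such that for every `w_r` with `0 < w̃ := w_r - w_l ≤ w̄` and
all `t ≥ 0`,
`‖∂_x ŵ(t)‖_{L^p} ≤ C min{w̃, w̃^(1/p)(1+t)^(-1+1/p)}` and
`‖∂_x² ŵ(t)‖_{L^p} ≤ C min{w̃, (1+t)^(-1)}`
(for `p = ∞`, `p.toReal = 0` and `1/p.toReal = 0` in Lean, so the first bound reads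
`w̃^0·(1+t)^(-1) = (1+t)^(-1)`, as in the stated interpretation). -/
theorem stmt6 (wl wbar : ℝ) (hwbar : 0 < wbar) (p : ℝ≥0∞) (hp : 1 ≤ p) :
    ∃ C : ℝ, 0 < C ∧ ∀ wr : ℝ, 0 < wr - wl → wr - wl ≤ wbar → ∀ t : ℝ, 0 ≤ t →
      eLpNorm (fun x => deriv (fun ξ => burgersSol wl wr t ξ) x) p volume
        ≤ ENNReal.ofReal (C * min (wr - wl)
            ((wr - wl) ^ (1 / p.toReal) * (1 + t) ^ (-1 + 1 / p.toReal))) ∧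
      eLpNorm (fun x => deriv (fun ξ => deriv (fun η => burgersSol wl wr t η) ξ) x)
          p volume
        ≤ ENNReal.ofReal (C * min (wr - wl) ((1 + t) ^ (-(1 : ℝ)))) := by
  refine ⟨2 * (1 + wbar), by positivity, fun wr h hle t ht => ?_⟩
  set M := (wr - wl) / 2 / (1 + t * ((wr - wl) / 2)) with hM
  obtain ⟨⟨hsup, hint⟩, hsup', hint'⟩ := burgersSol_deriv_bounds h ht hM
  set d := wr - wl
  have hMpos : 0 < M := by positivity
  have hMd : M ≤ d / 2 := div_le_self (by positivity) (le_add_of_nonneg_right (by positivity))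
  have hMt : M ≤ (1 + wbar) * (1 + t)⁻¹ := by
    rw [← div_eq_mul_inv, hM, div_le_div_iff₀ (by positivity) (by positivity)]
    have : 0 ≤ wbar * (t * (d / 2)) := by positivity
    nlinarith
  have hr0 : 0 ≤ 1 / p.toReal := by positivity
  have hr1 : 1 / p.toReal ≤ 1 := by
    rcases eq_or_ne p ⊤ with rfl | htop
    · simp
    · have hr : 1 ≤ p.toReal := by simpa using ENNReal.toReal_mono htop hp
      exact div_le_one_of_le₀ hr (by positivity)
  constructor
  · refine (eLpNorm_le_of_bound_of_lintegral_le hp hMpos h hsup hint).trans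
      (ENNReal.ofReal_le_ofReal ?_)
    set r := 1 / p.toReal
    rw [mul_min_of_nonneg _ _ (by positivity)]
    refine le_min ?_ ?_
    · calc M ^ (1 - r) * d ^ r ≤ d ^ (1 - r) * d ^ r := by
            gcongr
            linarith
        _ = d := by rw [← Real.rpow_add h]; simp
        _ ≤ 2 * (1 + wbar) * d := le_mul_of_one_le_left h.le (by linarith)
    · have hK : (1 + wbar) ^ (1 - r) ≤ 2 * (1 + wbar) := by
        calc (1 + wbar) ^ (1 - r) ≤ (1 + wbar) ^ (1 : ℝ) :=
              Real.rpow_le_rpow_of_exponent_le (by linarith) (by linarith)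
          _ ≤ _ := by rw [Real.rpow_one]; linarith
      calc M ^ (1 - r) * d ^ r ≤ ((1 + wbar) * (1 + t)⁻¹) ^ (1 - r) * d ^ r := by
            gcongr
        _ = (1 + wbar) ^ (1 - r) * (d ^ r * (1 + t) ^ (-1 + r)) := by
            rw [Real.mul_rpow (by positivity) (by positivity), Real.inv_rpow (by positivity),
              ← Real.rpow_neg (by positivity), neg_sub, sub_eq_neg_add r]
            ring
        _ ≤ _ := by gcongr
  · refine (eLpNorm_le_of_bound_of_lintegral_le hp (by positivity) (by positivity)
      hsup' hint').trans (ENNReal.ofReal_le_ofReal ?_)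
    rw [← Real.rpow_add (by positivity), sub_add_cancel, Real.rpow_one,
      mul_min_of_nonneg _ _ (by positivity), Real.rpow_neg_one]
    refine le_min ?_ (by linarith)
    have : 0 ≤ wbar * d := by positivity
    linarith
end

section
/- Let R, B > 0, γ > 1, s₋ ∈ ℝ, v₋ > 0, u₋ ∈ ℝ, and set λ₋(v) = −√(Bγ·v^(−γ−1)·exp((γ−1)s₋/R)) for v > 0, θ₋ = (B/R)·v₋^(1−γ)·exp((γ−1)s₋/R). Suppose ŵ : (0,∞) × ℝ → (−∞,0) is continuously differentiable and solves ∂_t ŵ + ŵ·∂_x ŵ = 0, and suppose V : (0,∞) × ℝ → (0,∞) is continuously differentiable with λ₋(V(t,x)) = ŵ(1+t, x) for all t, x. Define U(t,x) = u₋ − ∫_{v₋}^{V(t,x)} λ₋(η) dη and Θ(t,x) = θ₋·v₋^(γ−1)·V(t,x)^(1−γ). Then (V, U, Θ) solves the compressible Euler system: ∂_t V = ∂_x U, ∂_t U + ∂_x(RΘ/V) = 0, and (R/(γ−1))·∂_t Θ + (RΘ/V)·∂_x U = 0. -/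
open Real

/-- The integral of a function continuous on `(0,∞)` differentiates to the integrand. -/
lemma hasDerivAt_integral_of_continuousOn_Ioi {f : ℝ → ℝ} (hf : ContinuousOn f (Set.Ioi 0))
    {a b : ℝ} (ha : 0 < a) (hb : 0 < b) :
    HasDerivAt (fun v => ∫ η in a..v, f η) (f b) b := by
  refine intervalIntegral.integral_hasDerivAt_right ?_
    (hf.stronglyMeasurableAtFilter isOpen_Ioi b hb) (hf.continuousAt (Ioi_mem_nhds hb))
  refine (hf.mono fun y hy => ?_).intervalIntegrable
  exact (lt_min ha hb).trans_le hy.1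

/-- A function of two variables that is `C¹` on the upper half plane has partial derivatives. -/
lemma differentiableAt_partials_of_contDiffOn {V : ℝ → ℝ → ℝ}
    (hV : ContDiffOn ℝ 1 (fun q : ℝ × ℝ => V q.1 q.2) (Set.Ioi 0 ×ˢ Set.univ))
    {t : ℝ} (x : ℝ) (ht : 0 < t) :
    DifferentiableAt ℝ (fun τ => V τ x) t ∧ DifferentiableAt ℝ (fun ξ => V t ξ) x := by
  have hd : DifferentiableAt ℝ (fun q : ℝ × ℝ => V q.1 q.2) (t, x) :=
    (hV.contDiffAt ((isOpen_Ioi.prod isOpen_univ).mem_nhds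
      (Set.mk_mem_prod ht (Set.mem_univ x)))).differentiableAt
      one_ne_zero
  exact ⟨hd.comp (f := fun τ : ℝ => (τ, x)) t (by fun_prop),
    hd.comp (f := fun ξ : ℝ => (t, ξ)) x (by fun_prop)⟩

/-- The derivative of `v ↦ -√(K v^(-γ-1))` on the positive axis. -/
lemma hasDerivAt_neg_sqrt_mul_rpow {K γ v : ℝ} (hK : 0 < K) (hv : 0 < v) :
    HasDerivAt (fun v : ℝ => -√(K * v ^ (-γ - 1)))
      (-(K * ((-γ - 1) * v ^ (-γ - 1 - 1)) / (2 * √(K * v ^ (-γ - 1))))) v :=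
  (((hasDerivAt_rpow_const (Or.inl hv.ne')).const_mul K).sqrt (by positivity)).neg

/-- Smooth approximate 1-rarefaction wave construction: with
`λ₋(v) = -√(Bγ v^(-γ-1) e^{(γ-1)s₋/R})` and `θ₋ = (B/R) v₋^(1-γ) e^{(γ-1)s₋/R}`,
if `ŵ < 0` is a `C¹` solution of Burgers' equation on `(0,∞) × ℝ` and `V > 0` is `C¹`
with `λ₋(V(t,x)) = ŵ(1+t,x)`, then
`U = u₋ - ∫_{v₋}^{V} λ₋(η) dη` and `Θ = θ₋ v₋^{γ-1} V^{1-γ}` give a solution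
`(V,U,Θ)` of the compressible Euler system. -/
theorem stmt12 (R B γ sminus vminus uminus : ℝ)
    (hR : 0 < R) (hB : 0 < B) (hγ : 1 < γ) (hv : 0 < vminus)
    (lam : ℝ → ℝ)
    (hlam : ∀ v : ℝ, lam v
      = -Real.sqrt (B * γ * v ^ (-γ - 1) * Real.exp ((γ - 1) * sminus / R)))
    (θminus : ℝ)
    (hθ : θminus = (B / R) * vminus ^ (1 - γ) * Real.exp ((γ - 1) * sminus / R))
    (w : ℝ → ℝ → ℝ)
    (hwneg : ∀ t x : ℝ, 0 < t → w t x < 0)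
    (hwC1 : ContDiffOn ℝ 1 (fun q : ℝ × ℝ => w q.1 q.2) (Set.Ioi 0 ×ˢ Set.univ))
    (hwburgers : ∀ t x : ℝ, 0 < t →
      deriv (fun τ => w τ x) t + w t x * deriv (fun ξ => w t ξ) x = 0)
    (V : ℝ → ℝ → ℝ)
    (hVpos : ∀ t x : ℝ, 0 < t → 0 < V t x)
    (hVC1 : ContDiffOn ℝ 1 (fun q : ℝ × ℝ => V q.1 q.2) (Set.Ioi 0 ×ˢ Set.univ))
    (hVlam : ∀ t x : ℝ, 0 < t → lam (V t x) = w (1 + t) x)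
    (U Θ : ℝ → ℝ → ℝ)
    (hU : ∀ t x : ℝ, U t x = uminus - ∫ η in vminus..(V t x), lam η)
    (hΘ : ∀ t x : ℝ, Θ t x = θminus * vminus ^ (γ - 1) * (V t x) ^ (1 - γ)) :
    ∀ t x : ℝ, 0 < t →
      deriv (fun τ => V τ x) t = deriv (fun ξ => U t ξ) x ∧
      deriv (fun τ => U τ x) t + deriv (fun ξ => R * Θ t ξ / V t ξ) x = 0 ∧
      R / (γ - 1) * deriv (fun τ => Θ τ x) t
          + (R * Θ t x / V t x) * deriv (fun ξ => U t ξ) x = 0 := by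
  intro t x ht
  set E := Real.exp ((γ - 1) * sminus / R) with hE
  have hEpos : 0 < E := Real.exp_pos _
  set K := B * γ * E with hKdef
  have hK : 0 < K := by positivity
  have hlam_eq : lam = fun v : ℝ => -√(K * v ^ (-γ - 1)) := by
    funext v
    rw [hlam v, hKdef]
    ring_nf
  have hlam_deriv : ∀ v : ℝ, 0 < v → ∃ l : ℝ, l ≠ 0 ∧ HasDerivAt lam l v := by
    intro v hv0
    refine ⟨_, ?_, hlam_eq ▸ hasDerivAt_neg_sqrt_mul_rpow hK hv0⟩
    have h1 : -γ - 1 ≠ 0 := by linarith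
    have h2 : 0 < v ^ (-γ - 1 - 1) := rpow_pos_of_pos hv0 _
    have h3 : 0 < √(K * v ^ (-γ - 1)) := by positivity
    exact neg_ne_zero.2 (div_ne_zero (mul_ne_zero hK.ne' (mul_ne_zero h1 h2.ne')) (by positivity))
  have hlam_cont : ContinuousOn lam (Set.Ioi 0) := fun v hv0 => by
    obtain ⟨l, -, hl⟩ := hlam_deriv v hv0
    exact hl.continuousAt.continuousWithinAt
  have hv0 := hVpos t x ht
  have hlam_sq : lam (V t x) ^ 2 = K * V t x ^ (-γ - 1) := by
    rw [hlam_eq]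
    simp only [neg_sq]
    exact Real.sq_sqrt (by positivity)
  obtain ⟨hdt, hdx⟩ := differentiableAt_partials_of_contDiffOn hVC1 x ht
  have hVt := hdt.hasDerivAt
  have hVx := hdx.hasDerivAt
  set Vt := deriv (fun τ => V τ x) t
  set Vx := deriv (fun ξ => V t ξ) x
  obtain ⟨l, hl0, hl⟩ := hlam_deriv _ hv0
  have hwx : deriv (fun ξ => w (1 + t) ξ) x = l * Vx := by
    have h : (fun ξ => w (1 + t) ξ) = fun ξ => lam (V t ξ) :=
      funext fun ξ => (hVlam t ξ ht).symm
    rw [h]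
    exact (hl.comp x hVx).deriv
  have hwt : deriv (fun τ => w τ x) (1 + t) = l * Vt := by
    rw [← deriv_comp_const_add (f := fun τ => w τ x)]
    have h : (fun τ => w (1 + τ) x) =ᶠ[nhds t] fun τ => lam (V τ x) := by
      filter_upwards [Ioi_mem_nhds ht] with τ hτ using (hVlam τ x hτ).symm
    rw [h.deriv_eq]
    exact (hl.comp t hVt).deriv
  have hVtx : Vt = -(lam (V t x) * Vx) := by
    have h := hwburgers (1 + t) x (by linarith)
    rw [hwt, hwx, ← hVlam t x ht] at h
    have h' : l * (Vt + lam (V t x) * Vx) = 0 := by linarith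
    linarith [(mul_eq_zero.1 h').resolve_left hl0]
  have hI := hasDerivAt_integral_of_continuousOn_Ioi hlam_cont hv hv0
  have hUx : deriv (fun ξ => U t ξ) x = -(lam (V t x) * Vx) := by
    rw [funext (hU t)]
    exact ((hI.comp x hVx).const_sub uminus).deriv
  have hUt : deriv (fun τ => U τ x) t = -(lam (V t x) * Vt) := by
    rw [funext fun τ => hU τ x]
    exact ((hI.comp t hVt).const_sub uminus).deriv
  have hΘ' : ∀ τ ξ : ℝ, Θ τ ξ = B * E / R * V τ ξ ^ (1 - γ) := by
    intro τ ξ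
    have h : vminus ^ (1 - γ) * vminus ^ (γ - 1) = 1 := by
      rw [← rpow_add hv]
      simp
    rw [hΘ, hθ]
    linear_combination (B / R * E * V τ ξ ^ (1 - γ)) * h
  have hp : ∀ ξ : ℝ, R * Θ t ξ / V t ξ = B * E * V t ξ ^ (-γ) := by
    intro ξ
    have hξ := hVpos t ξ ht
    rw [hΘ', show 1 - γ = -γ + 1 by ring, rpow_add_one hξ.ne']
    field_simp
  have hpx : deriv (fun ξ => R * Θ t ξ / V t ξ) x
      = B * E * (-γ * V t x ^ (-γ - 1) * Vx) := by
    rw [funext hp]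
    exact (((hasDerivAt_rpow_const (Or.inl hv0.ne')).comp x hVx).const_mul (B * E)).deriv
  have hΘt : deriv (fun τ => Θ τ x) t = B * E / R * ((1 - γ) * V t x ^ (-γ) * Vt) := by
    rw [funext fun τ => hΘ' τ x, show -γ = 1 - γ - 1 by ring]
    exact (((hasDerivAt_rpow_const (Or.inl hv0.ne')).comp t hVt).const_mul (B * E / R)).deriv
  refine ⟨by rw [hUx, hVtx], ?_, ?_⟩
  · rw [hUt, hpx, hVtx]
    linear_combination Vx * hlam_sq
  · have hγ' : γ - 1 ≠ 0 := by linarith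
    rw [hΘt, hp, hUx, ← hVtx]
    field_simp
    ring
end

section
/- Let R > 0, γ > 1, 0 < m < 1 < M, and 0 < V₁ ≤ V₂, 0 < Θ₁ ≤ Θ₂. Then there exists a constant C > 0, depending only on R, γ, m, M, V₁, V₂, Θ₁, Θ₂, such that for all positive reals v, V, θ, Θ with V ∈ [V₁,V₂], Θ ∈ [Θ₁,Θ₂], m ≤ v/V ≤ M and m ≤ θ/Θ ≤ M, one has (RΘ/V)·( Φ(θV/(Θv)) + γ·Φ(v/V) ) ≥ C·( (v−V)² + (θ−Θ)² ), where Φ(s) = s − 1 − ln s. -/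
open Real

/-- The relative-entropy function `Φ(s) = s - 1 - ln s`. -/
noncomputable def Phi (s : ℝ) : ℝ := s - 1 - Real.log s

theorem sq_div_le_Phi {s S : ℝ} (hs : 0 < s) (hsS : s ≤ S) (hS : 1 ≤ S) :
    (s - 1) ^ 2 / (4 * S) ≤ Phi s := by
  have hr : 0 < √s := Real.sqrt_pos.2 hs
  have hsq : √s ^ 2 = s := Real.sq_sqrt hs.le
  have hlog : Real.log s ≤ 2 * (√s - 1) := by
    have h := Real.log_le_sub_one_of_pos hr
    rw [Real.log_sqrt hs.le] at h
    linarith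
  have hden : (√s + 1) ^ 2 ≤ 4 * S := by nlinarith [sq_nonneg (√s - 1)]
  have hfac : (s - 1) ^ 2 = (√s - 1) ^ 2 * (√s + 1) ^ 2 := by
    rw [← mul_pow, ← hsq]; simp only [Real.sqrt_sq hr.le]; ring
  have hPhi : (√s - 1) ^ 2 ≤ Phi s := by unfold Phi; nlinarith
  refine le_trans ?_ hPhi
  rw [div_le_iff₀ (by positivity), hfac]
  exact mul_le_mul_of_nonneg_left hden (sq_nonneg _)

theorem quadratic_le_Phi_add {γ m M a b : ℝ} (hγ : 1 < γ) (hm0 : 0 < m) (hm1 : m < 1)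
    (hM : 1 < M) (ham : m ≤ a) (haM : a ≤ M) (hb : 0 < b) (hbM : b ≤ M) :
    m / (12 * M ^ 3) * ((a - 1) ^ 2 + (b - 1) ^ 2) ≤ Phi (b / a) + γ * Phi a := by
  have ha : 0 < a := hm0.trans_le ham
  have hM0 : 0 < M := by linarith
  have hba : b / a ≤ M / m := div_le_div₀ hM0.le hbM hm0 ham
  have hMm : 1 ≤ M / m := by rw [le_div_iff₀ hm0]; linarith
  have h₁ := sq_div_le_Phi (div_pos hb ha) hba hMm
  have h₂ := sq_div_le_Phi ha haM hM.le
  have h₃ : m / (4 * M ^ 3) * (b - a) ^ 2 ≤ Phi (b / a) := by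
    refine le_trans ?_ h₁
    have e : (b / a - 1) ^ 2 / (4 * (M / m)) = m / (4 * M * a ^ 2) * (b - a) ^ 2 := by
      field_simp
    rw [e]
    refine mul_le_mul_of_nonneg_right ?_ (sq_nonneg _)
    apply div_le_div_of_nonneg_left hm0.le (by positivity)
    have : a ^ 2 ≤ M ^ 2 := pow_le_pow_left₀ ha.le haM 2
    nlinarith
  have h₄ : m / (4 * M ^ 3) * (a - 1) ^ 2 ≤ Phi a := by
    refine le_trans ?_ h₂
    have e : (a - 1) ^ 2 / (4 * M) = 1 / (4 * M) * (a - 1) ^ 2 := by ring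
    rw [e]
    refine mul_le_mul_of_nonneg_right ?_ (sq_nonneg _)
    apply div_le_div₀ zero_le_one hm1.le (by positivity)
    have : M ≤ M ^ 3 := le_self_pow₀ hM.le (by norm_num)
    linarith
  have h₅ : 0 ≤ Phi a := le_trans (by positivity) h₂
  have h₆ : Phi a ≤ γ * Phi a := le_mul_of_one_le_left h₅ hγ.le
  have hk : 0 ≤ m / (12 * M ^ 3) := by positivity
  have e : m / (4 * M ^ 3) = 3 * (m / (12 * M ^ 3)) := by field_simp; norm_num
  rw [e] at h₃ h₄
  have h₇ : (a - 1) ^ 2 + (b - 1) ^ 2 ≤ 3 * (b - a) ^ 2 + 3 * (a - 1) ^ 2 := by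
    nlinarith [sq_nonneg (b - a - (a - 1)), sq_nonneg (b - a)]
  have h₈ := mul_le_mul_of_nonneg_left h₇ hk
  linarith

/-- Quadratic lower bound for the relative entropy: for `R > 0`, `γ > 1`,
`0 < m < 1 < M` and `0 < V₁ ≤ V₂`, `0 < Θ₁ ≤ Θ₂`, there is `C > 0` (depending only
on these data) such that whenever `V ∈ [V₁,V₂]`, `Θ ∈ [Θ₁,Θ₂]`,
`m ≤ v/V ≤ M` and `m ≤ θ/Θ ≤ M`,
`(RΘ/V)(Φ(θV/(Θv)) + γΦ(v/V)) ≥ C((v-V)² + (θ-Θ)²)`. -/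
theorem stmt14 (R γ m M V₁ V₂ Θ₁ Θ₂ : ℝ) (hR : 0 < R) (hγ : 1 < γ)
    (hm0 : 0 < m) (hm1 : m < 1) (hM : 1 < M)
    (hV1 : 0 < V₁) (hV12 : V₁ ≤ V₂) (hΘ1 : 0 < Θ₁) (hΘ12 : Θ₁ ≤ Θ₂) :
    ∃ C : ℝ, 0 < C ∧ ∀ v V θ Θ : ℝ,
      0 < v → 0 < V → 0 < θ → 0 < Θ →
      V ∈ Set.Icc V₁ V₂ → Θ ∈ Set.Icc Θ₁ Θ₂ →
      m ≤ v / V → v / V ≤ M → m ≤ θ / Θ → θ / Θ ≤ M →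
      (R * Θ / V) * (Phi (θ * V / (Θ * v)) + γ * Phi (v / V))
        ≥ C * ((v - V) ^ 2 + (θ - Θ) ^ 2) := by
  have hV2 : 0 < V₂ := hV1.trans_le hV12
  have hΘ2 : 0 < Θ₂ := hΘ1.trans_le hΘ12
  have hM0 : 0 < M := by linarith
  refine ⟨R * Θ₁ / V₂ * (m / (12 * M ^ 3)) / (V₂ ^ 2 + Θ₂ ^ 2), by positivity, ?_⟩
  intro v V θ Θ hv hV hθ hΘ hVI hΘI hvm hvM hθm hθM
  have key := quadratic_le_Phi_add hγ hm0 hm1 hM hvm hvM (div_pos hθ hΘ) hθM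
  have hs : θ / Θ / (v / V) = θ * V / (Θ * v) := by field_simp
  rw [hs] at key
  have hcoef : R * Θ₁ / V₂ ≤ R * Θ / V :=
    div_le_div₀ (by positivity) (mul_le_mul_of_nonneg_left hΘI.1 hR.le) hV hVI.2
  have hv2 : (v - V) ^ 2 ≤ V₂ ^ 2 * (v / V - 1) ^ 2 := by
    have e : (v - V) ^ 2 = V ^ 2 * (v / V - 1) ^ 2 := by field_simp
    rw [e]
    exact mul_le_mul_of_nonneg_right (pow_le_pow_left₀ hV.le hVI.2 2) (sq_nonneg _)
  have hθ2 : (θ - Θ) ^ 2 ≤ Θ₂ ^ 2 * (θ / Θ - 1) ^ 2 := by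
    have e : (θ - Θ) ^ 2 = Θ ^ 2 * (θ / Θ - 1) ^ 2 := by field_simp
    rw [e]
    exact mul_le_mul_of_nonneg_right (pow_le_pow_left₀ hΘ.le hΘI.2 2) (sq_nonneg _)
  have hsum : (v - V) ^ 2 + (θ - Θ) ^ 2 ≤
      (V₂ ^ 2 + Θ₂ ^ 2) * ((v / V - 1) ^ 2 + (θ / Θ - 1) ^ 2) := by
    have p₁ : 0 ≤ V₂ ^ 2 * (θ / Θ - 1) ^ 2 := by positivity
    have p₂ : 0 ≤ Θ₂ ^ 2 * (v / V - 1) ^ 2 := by positivity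
    linarith
  calc R * Θ₁ / V₂ * (m / (12 * M ^ 3)) / (V₂ ^ 2 + Θ₂ ^ 2) * ((v - V) ^ 2 + (θ - Θ) ^ 2)
      ≤ R * Θ₁ / V₂ * (m / (12 * M ^ 3)) / (V₂ ^ 2 + Θ₂ ^ 2) *
          ((V₂ ^ 2 + Θ₂ ^ 2) * ((v / V - 1) ^ 2 + (θ / Θ - 1) ^ 2)) :=
        mul_le_mul_of_nonneg_left hsum (by positivity)
    _ = R * Θ₁ / V₂ * (m / (12 * M ^ 3) * ((v / V - 1) ^ 2 + (θ / Θ - 1) ^ 2)) := by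
        field_simp
    _ ≤ R * Θ / V * (Phi (θ * V / (Θ * v)) + γ * Phi (v / V)) :=
        mul_le_mul hcoef key (by positivity) (by positivity)
end
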